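/- arXiv:1808.01014 — 3 statements merged into one kernel-verified Lean document; each statement's English description precedes it below -/
import Mathlib

section
/- Let d ≥ 1, let Ω ⊆ ℝ^d be open, T > 0, ν > 0, ζ ∈ (0,2), C > 0, D > 0, and let ρ > 0 with ν^{1/(2−ζ)} < ρ. Let U ⊆ Ω be measurable with U + B(0,ρ) ⊆ Ω (where B(0,ρ) is the open ball of radius ρ). Let u : ℝ × ℝ^d → ℝ^d be measurable and such that for almost every t ∈ (0,T) the map u(t,·) is continuously differentiable on Ω. Assume (i) the dissipation bound ν · ∫_0^T ∫_Ω ‖∇u(t,x)‖² dx dt ≤ D, where ‖∇u(t,x)‖ is the operator norm of the spatial derivative, and (ii) the inertial-range structure function bound S₂(r) := ∫_0^T ∫_U |u(t,x+r) − u(t,x)|² dx dt ≤ C·|r|^ζ for every r ∈ ℝ^d with ν^{1/(2−ζ)} ≤ |r| < ρ. Then S₂(r) ≤ max(C, D)·|r|^ζ for every r ∈ ℝ^d with 0 < |r| < ρ. -/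
open MeasureTheory Set ENNReal

/-- Jensen's inequality for the square of a lower integral over a probability measure. -/
theorem lintegral_sq_le_lintegral_sq {α : Type*} [MeasurableSpace α] (μ : Measure α)
    [IsProbabilityMeasure μ] {g : α → ℝ≥0∞} (hg : AEMeasurable g μ) :
    (∫⁻ a, g a ∂μ) ^ 2 ≤ ∫⁻ a, g a ^ 2 ∂μ := by
  have h := ENNReal.lintegral_mul_le_Lp_mul_Lq μ Real.HolderConjugate.two_two hg
    (aemeasurable_const (b := (1 : ℝ≥0∞)))
  simp only [Pi.mul_apply, mul_one, lintegral_const, measure_univ,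
    ENNReal.rpow_two, one_pow, ENNReal.one_rpow] at h
  calc (∫⁻ a, g a ∂μ) ^ 2 ≤ ((∫⁻ a, g a ^ 2 ∂μ) ^ (1 / 2 : ℝ)) ^ 2 := by gcongr
    _ = ∫⁻ a, g a ^ 2 ∂μ := by
      rw [← ENNReal.rpow_two, ← ENNReal.rpow_mul]
      norm_num

section Increment

variable {E F : Type*} [NormedAddCommGroup E] [NormedSpace ℝ E]
  [NormedAddCommGroup F] [NormedSpace ℝ F] [CompleteSpace F]

/-- The increment of a `C¹` function along a segment is controlled by the mean of the norm of its
derivative on the segment. -/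
theorem enorm_sub_le_lintegral_fderiv {Ω : Set E} (hΩ : IsOpen Ω) {f : E → F}
    (hf : ContDiffOn ℝ 1 f Ω) {x r : E} (hseg : ∀ s ∈ Icc (0 : ℝ) 1, x + s • r ∈ Ω) :
    ‖f (x + r) - f x‖ₑ ≤ ‖r‖ₑ * ∫⁻ s in Ioc (0 : ℝ) 1, ‖fderiv ℝ f (x + s • r)‖ₑ := by
  have hderiv : ∀ s ∈ uIcc (0 : ℝ) 1,
      HasDerivAt (fun s : ℝ => f (x + s • r)) (fderiv ℝ f (x + s • r) r) s := by
    intro s hs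
    rw [uIcc_of_le zero_le_one] at hs
    have hfd : HasFDerivAt f (fderiv ℝ f (x + s • r)) (x + s • r) :=
      ((hf.differentiableOn one_ne_zero).differentiableAt
        (hΩ.mem_nhds (hseg s hs))).hasFDerivAt
    have hline : HasDerivAt (fun s : ℝ => x + s • r) r s := by
      simpa using ((hasDerivAt_id s).smul_const r).const_add x
    exact hfd.comp_hasDerivAt s hline
  have hcont : ContinuousOn (fun s : ℝ => fderiv ℝ f (x + s • r) r) (uIcc 0 1) := by
    rw [uIcc_of_le zero_le_one]
    exact ((hf.continuousOn_fderiv_of_isOpen hΩ le_rfl).comp (by fun_prop) hseg).clm_apply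
      continuousOn_const
  have hftc := intervalIntegral.integral_eq_sub_of_hasDerivAt hderiv hcont.intervalIntegrable
  simp only [one_smul, zero_smul, add_zero] at hftc
  rw [← hftc, intervalIntegral.integral_of_le zero_le_one,
    ← lintegral_const_mul' _ _ enorm_ne_top]
  refine (enorm_integral_le_lintegral_enorm _).trans (lintegral_mono fun s => ?_)
  rw [mul_comm]
  exact ContinuousLinearMap.le_opENorm _ _

/-- The mean-square increment of a `C¹` function over `U` is bounded by the Dirichlet energy on any
open set containing all the segments from `x ∈ U` to `x + r`. -/
theorem lintegral_enorm_sub_sq_le [MeasurableSpace E] [BorelSpace E]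
    [SecondCountableTopology E]
    (μ : Measure E) [SFinite μ] [μ.IsAddRightInvariant] {Ω U : Set E} (hΩ : IsOpen Ω)
    (hU : MeasurableSet U) {f : E → F} (hf : ContDiffOn ℝ 1 f Ω) {r : E}
    (hseg : ∀ x ∈ U, ∀ s ∈ Icc (0 : ℝ) 1, x + s • r ∈ Ω) :
    ∫⁻ x in U, ‖f (x + r) - f x‖ₑ ^ 2 ∂μ
      ≤ ‖r‖ₑ ^ 2 * ∫⁻ x in Ω, ‖fderiv ℝ f x‖ₑ ^ 2 ∂μ := by
  have : IsProbabilityMeasure (volume.restrict (Ioc (0 : ℝ) 1)) := ⟨by simp⟩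
  have hmeas : Measurable fun x => ‖fderiv ℝ f x‖ₑ :=
    (measurable_fderiv ℝ f).enorm
  have hpair : Measurable fun p : E × ℝ => ‖fderiv ℝ f (p.1 + p.2 • r)‖ₑ ^ 2 :=
    (hmeas.comp (by fun_prop : Continuous fun p : E × ℝ => p.1 + p.2 • r).measurable).pow_const 2
  calc ∫⁻ x in U, ‖f (x + r) - f x‖ₑ ^ 2 ∂μ
      ≤ ∫⁻ x in U, ‖r‖ₑ ^ 2 * (∫⁻ s in Ioc (0 : ℝ) 1, ‖fderiv ℝ f (x + s • r)‖ₑ ^ 2) ∂μ := by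
        refine setLIntegral_mono' hU fun x hx => ?_
        refine (pow_le_pow_left' (enorm_sub_le_lintegral_fderiv hΩ hf (hseg x hx)) 2).trans ?_
        rw [mul_pow]
        gcongr
        exact lintegral_sq_le_lintegral_sq _
          (hmeas.comp (by fun_prop : Continuous fun s : ℝ => x + s • r).measurable).aemeasurable
    _ = ‖r‖ₑ ^ 2 * ∫⁻ s in Ioc (0 : ℝ) 1, (∫⁻ x in U, ‖fderiv ℝ f (x + s • r)‖ₑ ^ 2 ∂μ) := by
        rw [lintegral_const_mul' _ _ (by simp), lintegral_lintegral_swap hpair.aemeasurable]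
    _ ≤ ‖r‖ₑ ^ 2 * ∫⁻ s in Ioc (0 : ℝ) 1, (∫⁻ x in Ω, ‖fderiv ℝ f x‖ₑ ^ 2 ∂μ) := by
        refine mul_le_mul_right ?_ _
        refine setLIntegral_mono' measurableSet_Ioc fun s hs => ?_
        calc ∫⁻ x in U, ‖fderiv ℝ f (x + s • r)‖ₑ ^ 2 ∂μ
            ≤ ∫⁻ x in (fun x => x + s • r) ⁻¹' Ω, ‖fderiv ℝ f (x + s • r)‖ₑ ^ 2 ∂μ :=
              lintegral_mono_set fun x hx => hseg x hx s (Ioc_subset_Icc_self hs)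
          _ = ∫⁻ x in Ω, ‖fderiv ℝ f x‖ₑ ^ 2 ∂μ :=
              (measurePreserving_add_right μ (s • r)).setLIntegral_comp_preimage
                hΩ.measurableSet (hmeas.pow_const 2)
    _ = ‖r‖ₑ ^ 2 * ∫⁻ x in Ω, ‖fderiv ℝ f x‖ₑ ^ 2 ∂μ := by simp

end Increment

/-- Below the dissipation length, a quadratic bound is stronger than the power law `a ^ ζ`. -/
theorem sq_le_mul_rpow_of_le_rpow {a ν ζ : ℝ} (ha : 0 < a) (hν : 0 < ν) (hζ : ζ < 2)
    (h : a ≤ ν ^ (1 / (2 - ζ))) : a ^ 2 ≤ ν * a ^ ζ := by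
  have hpos : 0 < 2 - ζ := sub_pos.2 hζ
  have hpow : a ^ (2 - ζ) ≤ ν := by
    calc a ^ (2 - ζ) ≤ (ν ^ (1 / (2 - ζ))) ^ (2 - ζ) := by gcongr
      _ = ν := by rw [← Real.rpow_mul hν.le, one_div_mul_cancel hpos.ne', Real.rpow_one]
  calc a ^ 2 = a ^ (2 - ζ) * a ^ ζ := by
        rw [← Real.rpow_add ha, sub_add_cancel, Real.rpow_two]
    _ ≤ ν * a ^ ζ := by gcongr

/-- Key step of Lemma 1: an inertial-range structure-function bound `S₂(r) ≤ C|r|^ζ` for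
`η(ν) := ν^(1/(2-ζ)) ≤ |r| < ρ`, together with the dissipation bound
`ν ∫₀^T ∫_Ω ‖∇u‖² ≤ D`, yields `S₂(r) ≤ max(C,D) |r|^ζ` at all scales `0 < |r| < ρ`. -/
theorem structure_function_bound_all_scales
    (d : ℕ) (hd : 1 ≤ d)
    (Ω : Set (EuclideanSpace ℝ (Fin d))) (hΩ : IsOpen Ω)
    (T ν ζ C D ρ : ℝ) (hT : 0 < T) (hν : 0 < ν) (hζ0 : 0 < ζ) (hζ2 : ζ < 2)
    (hC : 0 < C) (hD : 0 < D) (hρ : 0 < ρ) (hνρ : ν ^ (1 / (2 - ζ)) < ρ)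
    (U : Set (EuclideanSpace ℝ (Fin d))) (hU : MeasurableSet U)
    (hUΩ : ∀ x ∈ U, ∀ y ∈ Metric.ball (0 : EuclideanSpace ℝ (Fin d)) ρ, x + y ∈ Ω)
    (u : ℝ → EuclideanSpace ℝ (Fin d) → EuclideanSpace ℝ (Fin d))
    (humeas : Measurable (Function.uncurry u))
    (hureg : ∀ᵐ t ∂(volume.restrict (Ioo 0 T)), ContDiffOn ℝ 1 (u t) Ω)
    (hdiss : ENNReal.ofReal ν *
        ∫⁻ t in Ioo 0 T, ∫⁻ x in Ω, (‖fderiv ℝ (u t) x‖₊ : ℝ≥0∞) ^ 2 ∂volume ∂volume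
        ≤ ENNReal.ofReal D)
    (hinertial : ∀ r : EuclideanSpace ℝ (Fin d),
        ν ^ (1 / (2 - ζ)) ≤ ‖r‖ → ‖r‖ < ρ →
        ∫⁻ t in Ioo 0 T, ∫⁻ x in U, (‖u t (x + r) - u t x‖₊ : ℝ≥0∞) ^ 2 ∂volume ∂volume
          ≤ ENNReal.ofReal (C * ‖r‖ ^ ζ)) :
    ∀ r : EuclideanSpace ℝ (Fin d), 0 < ‖r‖ → ‖r‖ < ρ →
      ∫⁻ t in Ioo 0 T, ∫⁻ x in U, (‖u t (x + r) - u t x‖₊ : ℝ≥0∞) ^ 2 ∂volume ∂volume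
        ≤ ENNReal.ofReal (max C D * ‖r‖ ^ ζ) := by
  intro r hr0 hrρ
  rcases le_or_gt (ν ^ (1 / (2 - ζ))) ‖r‖ with hr | hr
  · refine (hinertial r hr hrρ).trans (ENNReal.ofReal_le_ofReal ?_)
    gcongr
    exact le_max_left _ _
  have hseg : ∀ x ∈ U, ∀ s ∈ Icc (0 : ℝ) 1, x + s • r ∈ Ω := by
    intro x hx s hs
    refine hUΩ x hx _ ?_
    rw [mem_ball_zero_iff, norm_smul, Real.norm_of_nonneg hs.1]
    exact (mul_le_of_le_one_left hr0.le hs.2).trans_lt hrρ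
  calc ∫⁻ t in Ioo 0 T, ∫⁻ x in U, (‖u t (x + r) - u t x‖₊ : ℝ≥0∞) ^ 2 ∂volume ∂volume
      ≤ ∫⁻ t in Ioo 0 T,
          ‖r‖ₑ ^ 2 * ∫⁻ x in Ω, (‖fderiv ℝ (u t) x‖₊ : ℝ≥0∞) ^ 2 ∂volume ∂volume :=
        lintegral_mono_ae (hureg.mono fun t ht => lintegral_enorm_sub_sq_le volume hΩ hU ht hseg)
    _ = ENNReal.ofReal (‖r‖ ^ 2) *
          ∫⁻ t in Ioo 0 T, ∫⁻ x in Ω, (‖fderiv ℝ (u t) x‖₊ : ℝ≥0∞) ^ 2 ∂volume ∂volume := by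
        rw [lintegral_const_mul' _ _ (by simp), ENNReal.ofReal_pow (norm_nonneg r), ofReal_norm]
    _ ≤ ENNReal.ofReal (‖r‖ ^ ζ * ν) *
          ∫⁻ t in Ioo 0 T, ∫⁻ x in Ω, (‖fderiv ℝ (u t) x‖₊ : ℝ≥0∞) ^ 2 ∂volume ∂volume := by
        gcongr
        rw [mul_comm]
        exact sq_le_mul_rpow_of_le_rpow hr0 hν hζ2 hr.le
    _ ≤ ENNReal.ofReal (‖r‖ ^ ζ) * ENNReal.ofReal D := by
        rw [ENNReal.ofReal_mul (by positivity), mul_assoc]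
        gcongr
    _ ≤ ENNReal.ofReal (max C D * ‖r‖ ^ ζ) := by
        rw [← ENNReal.ofReal_mul (by positivity), mul_comm]
        gcongr
        exact le_max_right _ _
end

section
/- Let u : ℝ³ → ℝ³ be three times continuously differentiable with div u = 0 on ℝ³, let χ : ℝ³ → ℝ be twice continuously differentiable, and set ω := curl u. Then for every x ∈ ℝ³, −Δ(χu)(x) = curl(χω)(x) − (∇χ × ω)(x) − 2·div(∇χ ⊗ u)(x) + u(x)·Δχ(x), where (∇χ ⊗ u)_{ij} := ∂ᵢχ · uⱼ, div(∇χ ⊗ u)ⱼ := Σᵢ ∂ᵢ(∂ᵢχ · uⱼ), × is the vector cross product in ℝ³, and Δ acts componentwise. -/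
/-- Partial derivative in direction `i` of a scalar function on `ℝ³`. -/
noncomputable def pd (i : Fin 3) (f : (Fin 3 → ℝ) → ℝ) : (Fin 3 → ℝ) → ℝ :=
  fun x => fderiv ℝ f x (Pi.single i 1)

/-- Curl of a vector field on `ℝ³`. -/
noncomputable def curl3 (u : (Fin 3 → ℝ) → (Fin 3 → ℝ)) : (Fin 3 → ℝ) → (Fin 3 → ℝ) :=
  fun x => ![pd 1 (fun y => u y 2) x - pd 2 (fun y => u y 1) x,
             pd 2 (fun y => u y 0) x - pd 0 (fun y => u y 2) x,
             pd 0 (fun y => u y 1) x - pd 1 (fun y => u y 0) x]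

/-- Divergence of a vector field on `ℝ³`. -/
noncomputable def div3 (u : (Fin 3 → ℝ) → (Fin 3 → ℝ)) : (Fin 3 → ℝ) → ℝ :=
  fun x => pd 0 (fun y => u y 0) x + pd 1 (fun y => u y 1) x + pd 2 (fun y => u y 2) x

/-- Laplacian of a scalar function on `ℝ³`. -/
noncomputable def lap3 (f : (Fin 3 → ℝ) → ℝ) : (Fin 3 → ℝ) → ℝ :=
  fun x => pd 0 (pd 0 f) x + pd 1 (pd 1 f) x + pd 2 (pd 2 f) x

/-- Gradient of a scalar function on `ℝ³`. -/
noncomputable def grad3 (f : (Fin 3 → ℝ) → ℝ) : (Fin 3 → ℝ) → (Fin 3 → ℝ) :=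
  fun x => ![pd 0 f x, pd 1 f x, pd 2 f x]

/-- Cross product on `ℝ³`. -/
def cross3 (a b : Fin 3 → ℝ) : Fin 3 → ℝ :=
  ![a 1 * b 2 - a 2 * b 1, a 2 * b 0 - a 0 * b 2, a 0 * b 1 - a 1 * b 0]

/-- `j`-th component of `div(∇χ ⊗ u)`, i.e. `Σᵢ ∂ᵢ(∂ᵢχ · uⱼ)`. -/
noncomputable def divGradTensor3 (χ : (Fin 3 → ℝ) → ℝ) (u : (Fin 3 → ℝ) → (Fin 3 → ℝ))
    (j : Fin 3) : (Fin 3 → ℝ) → ℝ :=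
  fun x => pd 0 (fun y => pd 0 χ y * u y j) x + pd 1 (fun y => pd 1 χ y * u y j) x +
    pd 2 (fun y => pd 2 χ y * u y j) x

/-- Product rule for partial derivatives. -/
theorem pd_mul {f g : (Fin 3 → ℝ) → ℝ} (hf : Differentiable ℝ f) (hg : Differentiable ℝ g)
    (i : Fin 3) :
    pd i (fun y => f y * g y) = fun y => f y * pd i g y + pd i f y * g y := by
  funext x
  simp only [pd]
  rw [fderiv_fun_mul (hf x) (hg x)]
  simp [mul_comm]

theorem pd_add {f g : (Fin 3 → ℝ) → ℝ} (hf : Differentiable ℝ f) (hg : Differentiable ℝ g)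
    (i : Fin 3) : pd i (fun y => f y + g y) = fun y => pd i f y + pd i g y := by
  funext x
  simp only [pd]
  rw [fderiv_fun_add (hf x) (hg x)]
  simp

theorem pd_sub {f g : (Fin 3 → ℝ) → ℝ} (hf : Differentiable ℝ f) (hg : Differentiable ℝ g)
    (i : Fin 3) : pd i (fun y => f y - g y) = fun y => pd i f y - pd i g y := by
  funext x
  simp only [pd]
  rw [fderiv_fun_sub (hf x) (hg x)]
  simp

theorem ContDiff.differentiable_pd {f : (Fin 3 → ℝ) → ℝ} (hf : ContDiff ℝ 2 f) (i : Fin 3) :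
    Differentiable ℝ (pd i f) :=
  ((hf.fderiv_right (m := 1) (by norm_num)).differentiable (by norm_num)).clm_apply
    (differentiable_const _)

/-- Partial derivatives of a `C²` function commute. -/
theorem pd_comm {f : (Fin 3 → ℝ) → ℝ} (hf : ContDiff ℝ 2 f) (i j : Fin 3) (x : Fin 3 → ℝ) :
    pd i (pd j f) x = pd j (pd i f) x := by
  have hd : DifferentiableAt ℝ (fderiv ℝ f) x :=
    (hf.fderiv_right (m := 1) (by norm_num)).differentiable (by norm_num) x
  have key (k l : Fin 3) : pd k (pd l f) x =
      fderiv ℝ (fderiv ℝ f) x (Pi.single k 1) (Pi.single l 1) := by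
    change fderiv ℝ (fun y => fderiv ℝ f y (Pi.single l 1)) x (Pi.single k 1) = _
    rw [fderiv_clm_apply hd (differentiableAt_const _)]
    simp
  rw [key, key]
  exact (hf.contDiffAt.isSymmSndFDerivAt (by simp)) _ _

/-- The localized elliptic identity
`−Δ(χu) = curl(χω) − ∇χ × ω − 2 div(∇χ ⊗ u) + u Δχ` for a divergence-free `C³`
vector field `u` on `ℝ³` with vorticity `ω = curl u` and a `C²` cutoff `χ`. -/
theorem localized_elliptic_identity_3d
    (u : (Fin 3 → ℝ) → (Fin 3 → ℝ)) (hu : ContDiff ℝ 3 u)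
    (hdiv : ∀ x, div3 u x = 0)
    (χ : (Fin 3 → ℝ) → ℝ) (hχ : ContDiff ℝ 2 χ)
    (ω : (Fin 3 → ℝ) → (Fin 3 → ℝ)) (hω : ω = curl3 u) :
    ∀ (x : Fin 3 → ℝ) (j : Fin 3),
      -lap3 (fun y => χ y * u y j) x =
        curl3 (fun y => fun i => χ y * ω y i) x j
          - cross3 (grad3 χ x) (ω x) j
          - 2 * divGradTensor3 χ u j x
          + u x j * lap3 χ x := by
  intro x j
  subst hω
  have hu2 (k : Fin 3) : ContDiff ℝ 2 (fun y => u y k) :=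
    ((contDiff_pi.mp hu) k).of_le (by norm_num)
  have du (k : Fin 3) : Differentiable ℝ (fun y => u y k) := (hu2 k).differentiable (by norm_num)
  have dχ : Differentiable ℝ χ := hχ.differentiable (by norm_num)
  have dpu (i k : Fin 3) : Differentiable ℝ (pd i (fun y => u y k)) := (hu2 k).differentiable_pd i
  have dpχ (i : Fin 3) : Differentiable ℝ (pd i χ) := hχ.differentiable_pd i
  have lap (i k : Fin 3) : pd i (pd i (fun y => χ y * u y k)) x =
      χ x * pd i (pd i (fun y => u y k)) x + 2 * (pd i χ x * pd i (fun y => u y k) x)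
        + pd i (pd i χ) x * u x k := by
    rw [pd_mul dχ (du k), pd_add (dχ.fun_mul (dpu i k)) ((dpχ i).fun_mul (du k)),
      pd_mul dχ (dpu i k), pd_mul (dpχ i) (du k)]
    ring
  have tensor (i k : Fin 3) : pd i (fun y => pd i χ y * u y k) x =
      pd i χ x * pd i (fun y => u y k) x + pd i (pd i χ) x * u x k := by
    rw [pd_mul (dpχ i) (du k)]
  have vort (i a b c d : Fin 3) :
      pd i (fun y => χ y * (pd a (fun z => u z b) y - pd c (fun z => u z d) y)) x =
      χ x * (pd i (pd a (fun z => u z b)) x - pd i (pd c (fun z => u z d)) x)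
        + pd i χ x * (pd a (fun z => u z b) x - pd c (fun z => u z d) x) := by
    rw [pd_mul dχ ((dpu a b).fun_sub (dpu c d)), pd_sub (dpu a b) (dpu c d)]
  have gradDiv (i : Fin 3) : pd i (pd 0 (fun y => u y 0)) x + pd i (pd 1 (fun y => u y 1)) x
      + pd i (pd 2 (fun y => u y 2)) x = 0 := by
    have h : pd i (div3 u) x = 0 := by
      rw [show div3 u = fun _ => 0 from funext hdiv]
      simp [pd]
    unfold div3 at h
    rwa [pd_add ((dpu 0 0).fun_add (dpu 1 1)) (dpu 2 2), pd_add (dpu 0 0) (dpu 1 1)] at h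
  have comm (i k l : Fin 3) := pd_comm (hu2 l) i k x
  fin_cases j
  · simp [lap3, curl3, cross3, grad3, divGradTensor3, lap, tensor, vort]
    linear_combination (-χ x) * gradDiv 0 + χ x * comm 0 1 1 + χ x * comm 0 2 2
  · simp [lap3, curl3, cross3, grad3, divGradTensor3, lap, tensor, vort]
    linear_combination (-χ x) * gradDiv 1 + χ x * comm 1 0 0 + χ x * comm 1 2 2
  · simp [lap3, curl3, cross3, grad3, divGradTensor3, lap, tensor, vort]
    linear_combination (-χ x) * gradDiv 2 + χ x * comm 2 0 0 + χ x * comm 2 1 1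
end

section
/- Let u : ℝ² → ℝ² be three times continuously differentiable with div u = 0 on ℝ², let χ : ℝ² → ℝ be twice continuously differentiable, and set ω := ∂₁u₂ − ∂₂u₁. Then for every x ∈ ℝ², −Δ(χu)(x) = ∇^⊥(χω)(x) − ω(x)·∇^⊥χ(x) − 2·div(∇χ ⊗ u)(x) + u(x)·Δχ(x), where ∇^⊥f := (∂₂f, −∂₁f), (∇χ ⊗ u)_{ij} := ∂ᵢχ · uⱼ, div(∇χ ⊗ u)ⱼ := Σᵢ ∂ᵢ(∂ᵢχ · uⱼ), and Δ acts componentwise. -/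
/-- Partial derivative in direction `i` of a scalar function on `ℝ²`. -/
noncomputable def pd2 (i : Fin 2) (f : (Fin 2 → ℝ) → ℝ) : (Fin 2 → ℝ) → ℝ :=
  fun x => fderiv ℝ f x (Pi.single i 1)

/-- Laplacian of a scalar function on `ℝ²`. -/
noncomputable def lap2 (f : (Fin 2 → ℝ) → ℝ) : (Fin 2 → ℝ) → ℝ :=
  fun x => pd2 0 (pd2 0 f) x + pd2 1 (pd2 1 f) x

/-- Perpendicular gradient `∇^⊥ f := (∂₂f, −∂₁f)` of a scalar function on `ℝ²`. -/
noncomputable def perpGrad2 (f : (Fin 2 → ℝ) → ℝ) : (Fin 2 → ℝ) → (Fin 2 → ℝ) :=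
  fun x => ![pd2 1 f x, -pd2 0 f x]

/-- `j`-th component of `div(∇χ ⊗ u)`, i.e. `Σᵢ ∂ᵢ(∂ᵢχ · uⱼ)`. -/
noncomputable def divGradTensor2 (χ : (Fin 2 → ℝ) → ℝ) (u : (Fin 2 → ℝ) → (Fin 2 → ℝ))
    (j : Fin 2) : (Fin 2 → ℝ) → ℝ :=
  fun x => pd2 0 (fun y => pd2 0 χ y * u y j) x + pd2 1 (fun y => pd2 1 χ y * u y j) x

theorem contDiff_pd2 {n m : WithTop ℕ∞} {f : (Fin 2 → ℝ) → ℝ} (hf : ContDiff ℝ n f)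
    (hmn : m + 1 ≤ n) (i : Fin 2) : ContDiff ℝ m (pd2 i f) :=
  (hf.fderiv_right hmn).clm_apply contDiff_const

theorem pd2_mul {f g : (Fin 2 → ℝ) → ℝ} (hf : Differentiable ℝ f) (hg : Differentiable ℝ g)
    (i : Fin 2) : pd2 i (fun y => f y * g y) = fun x => f x * pd2 i g x + g x * pd2 i f x := by
  ext x
  simp [pd2, fderiv_fun_mul (hf x) (hg x)]

theorem pd2_add {f g : (Fin 2 → ℝ) → ℝ} (hf : Differentiable ℝ f) (hg : Differentiable ℝ g)
    (i : Fin 2) : pd2 i (fun y => f y + g y) = fun x => pd2 i f x + pd2 i g x := by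
  ext x
  simp [pd2, fderiv_fun_add (hf x) (hg x)]

theorem pd2_sub {f g : (Fin 2 → ℝ) → ℝ} (hf : Differentiable ℝ f) (hg : Differentiable ℝ g)
    (i : Fin 2) : pd2 i (fun y => f y - g y) = fun x => pd2 i f x - pd2 i g x := by
  ext x
  simp [pd2, fderiv_fun_sub (hf x) (hg x)]

/-- Symmetry of second partial derivatives. -/
theorem pd2_comm {f : (Fin 2 → ℝ) → ℝ} (hf : ContDiff ℝ 2 f) (i j : Fin 2) (x : Fin 2 → ℝ) :
    pd2 i (pd2 j f) x = pd2 j (pd2 i f) x := by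
  have hd : DifferentiableAt ℝ (fderiv ℝ f) x :=
    (hf.fderiv_right (m := 1) (by norm_num)).differentiable (by norm_num) x
  have key (a b : Fin 2) :
      pd2 a (pd2 b f) x = fderiv ℝ (fderiv ℝ f) x (Pi.single a 1) (Pi.single b 1) := by
    unfold pd2
    simp [fderiv_clm_apply hd (differentiableAt_const _)]
  rw [key, key]
  exact (hf.contDiffAt.isSymmSndFDerivAt (by simp)) _ _

/-- The Laplacian of a product. -/
theorem lap2_mul {f g : (Fin 2 → ℝ) → ℝ} (hf : ContDiff ℝ 2 f) (hg : ContDiff ℝ 2 g)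
    (x : Fin 2 → ℝ) :
    lap2 (fun y => f y * g y) x = f x * lap2 g x
      + 2 * (pd2 0 f x * pd2 0 g x + pd2 1 f x * pd2 1 g x) + g x * lap2 f x := by
  have hf' := hf.differentiable (by norm_num)
  have hg' := hg.differentiable (by norm_num)
  have df (i : Fin 2) : Differentiable ℝ (pd2 i f) :=
    (contDiff_pd2 (m := 1) hf (by norm_num) i).differentiable (by norm_num)
  have dg (i : Fin 2) : Differentiable ℝ (pd2 i g) :=
    (contDiff_pd2 (m := 1) hg (by norm_num) i).differentiable (by norm_num)
  have second (i : Fin 2) : pd2 i (pd2 i (fun y => f y * g y)) x =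
      f x * pd2 i (pd2 i g) x + 2 * (pd2 i f x * pd2 i g x) + g x * pd2 i (pd2 i f) x := by
    rw [pd2_mul hf' hg', pd2_add (hf'.fun_mul (dg i)) (hg'.fun_mul (df i)), pd2_mul hf' (dg i),
      pd2_mul hg' (df i)]
    ring
  simp only [lap2, second]
  ring

/-- For a divergence-free field, `∇^⊥ω = -Δu`. -/
theorem perpGrad2_vorticity {u : (Fin 2 → ℝ) → (Fin 2 → ℝ)} (hu : ContDiff ℝ 2 u)
    (hdiv : ∀ x, pd2 0 (fun y => u y 0) x + pd2 1 (fun y => u y 1) x = 0)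
    (x : Fin 2 → ℝ) (j : Fin 2) :
    perpGrad2 (fun x => pd2 0 (fun y => u y 1) x - pd2 1 (fun y => u y 0) x) x j =
      -lap2 (fun y => u y j) x := by
  have hc (k : Fin 2) : ContDiff ℝ 2 (fun y => u y k) := contDiff_pi.1 hu k
  have d (i k : Fin 2) : Differentiable ℝ (pd2 i (fun y => u y k)) :=
    (contDiff_pd2 (m := 1) (hc k) (by norm_num) i).differentiable (by norm_num)
  have hdd (i : Fin 2) :
      pd2 i (pd2 0 (fun y => u y 0)) x + pd2 i (pd2 1 (fun y => u y 1)) x = 0 := by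
    have h := congrFun (pd2_add (d 0 0) (d 1 1) i) x
    rw [funext hdiv] at h
    simpa [pd2] using h.symm
  have h0 := hdd 0
  have h1 := hdd 1
  rw [pd2_comm (hc 1)] at h0
  rw [pd2_comm (hc 0)] at h1
  fin_cases j <;> simp [perpGrad2, lap2, pd2_sub (d 0 1) (d 1 0)] <;> linarith

/-- The perpendicular gradient of a product. -/
theorem perpGrad2_mul {f g : (Fin 2 → ℝ) → ℝ} (hf : Differentiable ℝ f)
    (hg : Differentiable ℝ g) (x : Fin 2 → ℝ) (j : Fin 2) :
    perpGrad2 (fun y => f y * g y) x j = f x * perpGrad2 g x j + g x * perpGrad2 f x j := by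
  fin_cases j <;> simp [perpGrad2, pd2_mul hf hg]
  ring

/-- The two-dimensional localized elliptic identity
`−Δ(χu) = ∇^⊥(χω) − ω ∇^⊥χ − 2 div(∇χ ⊗ u) + u Δχ` for a divergence-free `C³`
planar vector field `u` with scalar vorticity `ω = ∂₁u₂ − ∂₂u₁` and a `C²` cutoff `χ`. -/
theorem localized_elliptic_identity_2d
    (u : (Fin 2 → ℝ) → (Fin 2 → ℝ)) (hu : ContDiff ℝ 3 u)
    (hdiv : ∀ x, pd2 0 (fun y => u y 0) x + pd2 1 (fun y => u y 1) x = 0)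
    (χ : (Fin 2 → ℝ) → ℝ) (hχ : ContDiff ℝ 2 χ)
    (ω : (Fin 2 → ℝ) → ℝ)
    (hω : ω = fun x => pd2 0 (fun y => u y 1) x - pd2 1 (fun y => u y 0) x) :
    ∀ (x : Fin 2 → ℝ) (j : Fin 2),
      -lap2 (fun y => χ y * u y j) x =
        perpGrad2 (fun y => χ y * ω y) x j
          - ω x * perpGrad2 χ x j
          - 2 * divGradTensor2 χ u j x
          + u x j * lap2 χ x := by
  intro x j
  have hu2 : ContDiff ℝ 2 u := hu.of_le (by norm_num)
  have hc (k : Fin 2) : ContDiff ℝ 2 (fun y => u y k) := contDiff_pi.1 hu2 k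
  have dχ := hχ.differentiable (by norm_num)
  have dc (k : Fin 2) := (hc k).differentiable (by norm_num)
  have d (i k : Fin 2) : Differentiable ℝ (pd2 i (fun y => u y k)) :=
    (contDiff_pd2 (m := 1) (hc k) (by norm_num) i).differentiable (by norm_num)
  have dpχ (i : Fin 2) : Differentiable ℝ (pd2 i χ) :=
    (contDiff_pd2 (m := 1) hχ (by norm_num) i).differentiable (by norm_num)
  have dω : Differentiable ℝ ω := hω ▸ (d 0 1).sub (d 1 0)
  have hcurl : perpGrad2 ω x j = -lap2 (fun y => u y j) x :=
    hω ▸ perpGrad2_vorticity hu2 hdiv x j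
  rw [lap2_mul hχ (hc j), perpGrad2_mul dχ dω, hcurl]
  simp only [divGradTensor2, pd2_mul (dpχ _) (dc j), lap2]
  ring
end
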